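/- Let X be a topological space of finite cohomological dimension whose cohomology ring H•(X; k) with coefficients in a field k vanishes in odd degrees, and let F be a bounded complex of k-sheaves on X with locally constant (in fact constant) cohomology sheaves. If Hom•(F, k_X) is a free graded H•(X;k)-module generated in even degrees, then F is isomorphic in the derived category to a finite direct sum of even shifts k_X[2n_i] of the constant sheaf. -/

import Mathlib

open CategoryTheory CategoryTheory.Limits TopCat

attribute [local instance] HasDerivedCategory.standard

section sheafpart
open Opposite TopologicalSpace

variable {k : Type} [Field k] {X : TopCat.{0}}

/-- constant sheaf -/
noncomputable abbrev cSh (X : TopCat.{0}) (V : ModuleCat.{0} k) :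
    Sheaf (Opens.grothendieckTopology X) (ModuleCat.{0} k) :=
  (constantSheaf (Opens.grothendieckTopology X) (ModuleCat.{0} k)).obj V

/-- the constant sections -/
noncomputable def cEta (V : ModuleCat.{0} k) (U : Opens X) : V ⟶ (cSh X V).obj.obj (op U) :=
  (toSheafify (Opens.grothendieckTopology X) ((Functor.const _).obj V)).app (op U)

lemma cEta_map (V : ModuleCat.{0} k) {U U' : Opens X} (i : U' ⟶ U) :
    cEta V U ≫ (cSh X V).obj.map i.op = cEta V U' := by
  have := (toSheafify (Opens.grothendieckTopology X) ((Functor.const _).obj V)).naturality i.op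
  exact this.symm.trans (Category.id_comp _)

lemma pinv_exists {V W : ModuleCat.{0} k} (φ : V ⟶ W) : ∃ ψ : W ⟶ V, φ ≫ ψ ≫ φ = φ := by
  obtain ⟨s, hs⟩ := φ.hom.rangeRestrict.exists_rightInverse_of_surjective
    (LinearMap.range_rangeRestrict _)
  obtain ⟨t, ht⟩ := (LinearMap.range φ.hom).subtype.exists_leftInverse_of_injective
    (Submodule.ker_subtype _)
  refine ⟨ModuleCat.ofHom (s ∘ₗ t), ?_⟩
  ext v
  have h1 : t (φ.hom v) = φ.hom.rangeRestrict v :=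
    LinearMap.congr_fun ht (φ.hom.rangeRestrict v)
  have h2 : φ.hom (s (φ.hom.rangeRestrict v)) = φ.hom v :=
    congrArg Subtype.val (LinearMap.congr_fun hs (φ.hom.rangeRestrict v))
  change φ.hom (s (t (φ.hom v))) = φ.hom v
  rw [h1, h2]

/-- pseudo-inverse -/
noncomputable def pinv {V W : ModuleCat.{0} k} (φ : V ⟶ W) : W ⟶ V := (pinv_exists φ).choose
lemma pinv_spec {V W : ModuleCat.{0} k} (φ : V ⟶ W) : φ ≫ pinv φ ≫ φ = φ :=
  (pinv_exists φ).choose_spec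

lemma cEta_inj {V W : ModuleCat.{0} k} (U : Opens X) (x : X) (hx : x ∈ U) (φ ψ : V ⟶ W)
    (h : φ ≫ cEta W U = ψ ≫ cEta W U) : φ = ψ := by
  ext v
  have h1 := Presheaf.equalizerSieve_mem (Opens.grothendieckTopology X)
    (toSheafify (Opens.grothendieckTopology X) ((Functor.const _).obj W)) (X := op U)
    (φ v) (ψ v) (ConcreteCategory.congr_hom h v)
  obtain ⟨U', i, hi, -⟩ := h1 x hx
  exact hi

lemma cSh_hom_ext_empty {V W : ModuleCat.{0} k} (U : Opens X) (h : ∀ x, x ∉ U)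
    (a b : V ⟶ (cSh X W).obj.obj (op U)) : a = b := by
  refine (cSh X W).property.hom_ext ⟨⊥, fun x hx => (h x hx).elim⟩ a b ?_
  rintro ⟨Y, f, hf⟩
  exact hf.elim

lemma cEta_pinv {V W : ModuleCat.{0} k} (U : Opens X) (φ ψ : V ⟶ W)
    (h : φ ≫ cEta W U = ψ ≫ cEta W U) : pinv φ ≫ cEta V U = pinv ψ ≫ cEta V U := by
  by_cases hU : ∃ x, x ∈ U
  · obtain ⟨x, hx⟩ := hU
    rw [cEta_inj U x hx φ ψ h]
  · push Not at hU
    exact cSh_hom_ext_empty U hU _ _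

lemma cSh_hom_ext {V W : ModuleCat.{0} k} (f g : cSh X V ⟶ cSh X W)
    (h : cEta V ⊤ ≫ f.hom.app (op ⊤) = cEta V ⊤ ≫ g.hom.app (op ⊤)) : f = g := by
  apply CategoryTheory.Sheaf.hom_ext
  apply sheafify_hom_ext _ _ _ (cSh X W).property
  ext1
  ext1 ⟨U⟩
  change cEta V U ≫ f.hom.app (op U) = cEta V U ≫ g.hom.app (op U)
  have i : U ⟶ ⊤ := homOfLE le_top
  rw [← cEta_map V i, Category.assoc, Category.assoc, f.hom.naturality, g.hom.naturality,
    reassoc_of% h]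

lemma cSh_lift {V W : ModuleCat.{0} k} (a : V ⟶ (cSh X W).obj.obj (op ⊤)) :
    ∃ f : cSh X V ⟶ cSh X W, cEta V ⊤ ≫ f.hom.app (op ⊤) = a := by
  let t : (Functor.const _).obj V ⟶ (cSh X W).obj :=
    { app := fun U => a ≫ (cSh X W).obj.map (homOfLE le_top : U.unop ⟶ ⊤).op
      naturality := by
        intro U U' i
        simp only [Functor.const_obj_obj, Functor.const_obj_map, Category.id_comp, Category.assoc,
          ← Functor.map_comp]
        rfl }
  refine ⟨⟨sheafifyLift _ t (cSh X W).property⟩, ?_⟩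
  have h := congrArg (fun z => z.app (op ⊤))
    (toSheafify_sheafifyLift (Opens.grothendieckTopology X) t (cSh X W).property)
  refine Eq.trans h ?_
  change a ≫ (cSh X W).obj.map (𝟙 _) = a
  simp

lemma cover_lemma {r : ℕ} {W : ModuleCat.{0} k}
    (f : cSh X (ModuleCat.of k (Fin r → k)) ⟶ cSh X W) (x : X) :
    ∃ U : Opens X, x ∈ U ∧ ∃ φ : ModuleCat.of k (Fin r → k) ⟶ W,
      cEta _ U ≫ f.hom.app (op U) = φ ≫ cEta W U := by
  have h1 : ∀ i : Fin r, ∃ U : Opens X, x ∈ U ∧ ∃ w : W,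
      f.hom.app (op U) (cEta (ModuleCat.of k (Fin r → k)) U (Pi.single i 1 : Fin r → k)) =
        cEta W U w := by
    intro i
    have h := Presheaf.imageSieve_mem (Opens.grothendieckTopology X)
      (toSheafify (Opens.grothendieckTopology X) ((Functor.const _).obj W)) (U := op ⊤)
      (f.hom.app (op ⊤) (cEta (ModuleCat.of k (Fin r → k)) ⊤ (Pi.single i 1 : Fin r → k)))
    obtain ⟨U, j, ⟨w, hw⟩, hx⟩ := h x trivial
    refine ⟨U, hx, w, ?_⟩
    refine Eq.trans ?_ hw.symm
    rw [← cEta_map _ j]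
    exact (ConcreteCategory.congr_hom (f.hom.naturality j.op) _)
  choose U hU w hw using h1
  refine ⟨Finset.univ.inf U, ?_, ModuleCat.ofHom ((Pi.basisFun k (Fin r)).constr k w), ?_⟩
  · rw [← SetLike.mem_coe, Opens.coe_finset_inf]
    simp [hU]
  · apply ModuleCat.hom_ext
    apply (Pi.basisFun k (Fin r)).ext
    intro i
    have j : Finset.univ.inf U ⟶ U i := homOfLE (Finset.inf_le (Finset.mem_univ i))
    have h2 := congrArg ((cSh X W).obj.map j.op) (hw i)
    have h3 := ConcreteCategory.congr_hom (cEta_map W j) (w i)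
    have h4 := ConcreteCategory.congr_hom (f.hom.naturality j.op)
      (cEta (ModuleCat.of k (Fin r → k)) (U i) (Pi.single i 1 : Fin r → k))
    have h5 := ConcreteCategory.congr_hom (cEta_map (ModuleCat.of k (Fin r → k)) j)
       (Pi.single i 1 : Fin r → k)
    have h6 : ((Pi.basisFun k (Fin r)).constr k w) ((Pi.basisFun k (Fin r)) i) = w i :=
      Module.Basis.constr_basis _ _ _ _
    change f.hom.app _ (cEta _ _ ((Pi.basisFun k (Fin r)) i)) =
      cEta W _ (((Pi.basisFun k (Fin r)).constr k w) ((Pi.basisFun k (Fin r)) i))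
    rw [h6, Pi.basisFun_apply]
    refine Eq.trans ?_ (h2.trans h3)
    refine Eq.trans ?_ h4
    exact (congrArg (f.hom.app (op (Finset.univ.inf U))) h5).symm

lemma cSh_regular {r : ℕ} {W : ModuleCat.{0} k}
    (f : cSh X (ModuleCat.of k (Fin r → k)) ⟶ cSh X W) :
    ∃ g : cSh X W ⟶ cSh X (ModuleCat.of k (Fin r → k)), f ≫ g ≫ f = f := by
  choose U hU φ hφ using cover_lemma f
  have hcov : Sieve.ofArrows U (fun x => (homOfLE le_top : U x ⟶ ⊤)) ∈
      (Opens.grothendieckTopology X) ⊤ := by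
    intro x _
    exact ⟨U x, homOfLE le_top, Sieve.ofArrows_mk _ _ x, hU x⟩
  let V := ModuleCat.of k (Fin r → k)
  have hres : ∀ (x : X) {Z : Opens X} (a : Z ⟶ U x),
      cEta V Z ≫ f.hom.app (op Z) = φ x ≫ cEta W Z := by
    intro x Z a
    rw [← cEta_map W a, ← reassoc_of% (hφ x), ← f.hom.naturality, reassoc_of% (cEta_map _ a)]
  obtain ⟨g0, hg0, -⟩ := (cSh X V).property.existsUnique_amalgamation_ofArrows
    (fun x => (homOfLE le_top : U x ⟶ ⊤)) hcov
    (fun x => pinv (φ x) ≫ cEta V (U x)) (by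
      intro Z x y a b _
      rw [Category.assoc, Category.assoc, cEta_map, cEta_map]
      apply cEta_pinv
      rw [← hres x a, ← hres y b])
  obtain ⟨g, hg⟩ := cSh_lift g0
  have hg' : ∀ x, cEta W (U x) ≫ g.hom.app (op (U x)) = pinv (φ x) ≫ cEta V (U x) := by
    intro x
    rw [← hg0 x, ← hg, ← cEta_map W (homOfLE le_top : U x ⟶ ⊤), Category.assoc, Category.assoc,
      ← g.hom.naturality]
  refine ⟨g, cSh_hom_ext _ _ ?_⟩
  apply (cSh X W).property.hom_ext_ofArrows _ hcov
  intro x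
  rw [Category.assoc, Category.assoc, ← NatTrans.naturality, ← NatTrans.naturality,
    reassoc_of% (cEta_map V _), reassoc_of% (cEta_map V _)]
  change cEta V (U x) ≫ f.hom.app _ ≫ g.hom.app _ ≫ f.hom.app _ = _
  rw [reassoc_of% (hφ x), reassoc_of% (hg' x), hφ x]
  rw [reassoc_of% (pinv_spec (φ x))]
end sheafpart


section general
open Pretriangulated DerivedCategory

variable {C : Type*} [Category C] [Abelian C] [HasDerivedCategory C]

lemma aux_trunc (G : DerivedCategory C) (b : ℤ) (hG : G.IsLE b) (K : C)
    (h : ∀ φ : G ⟶ (singleFunctor C b).obj K, φ = 0)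
    (α : (homologyFunctor C b).obj G ⟶ K) : α = 0 := by
  obtain ⟨A, B, hA, hB, i, p, d, hT⟩ := (TStructure.t (C := C)).exists_triangle G (b-1) b (by ring)
  have hA' : A.IsLE (b-1) := ⟨hA⟩
  have hB' : B.IsGE b := ⟨hB⟩
  have hA0 : ∀ j, b ≤ j → IsZero ((homologyFunctor C j).obj A) := fun j hj =>
    isZero_of_isLE A (b-1) j (by lia)
  have hiso : ∀ j, b ≤ j → IsIso ((homologyFunctor C j).map p) := by
    intro j hj
    have h1 : Mono ((homologyFunctor C j).map p) :=
      (HomologySequence.mono_homologyMap_mor₂_iff _ hT j).2 ((hA0 j hj).eq_of_src _ _)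
    have h2 : Epi ((homologyFunctor C j).map p) :=
      (HomologySequence.epi_homologyMap_mor₂_iff _ hT j (j+1) rfl).2
        ((hA0 (j+1) (by lia)).eq_of_tgt _ _)
    exact isIso_of_mono_of_epi _
  have hB'' : B.IsLE b := by
    rw [isLE_iff]
    intro j hj
    have := hiso j hj.le
    exact (isZero_of_isLE G b j hj).of_iso (asIso ((homologyFunctor C j).map p)).symm
  obtain ⟨Y, ⟨e⟩⟩ := exists_iso_singleFunctor_obj_of_isGE_of_isLE B b
  have := hiso b le_rfl
  let s := singleFunctorCompHomologyFunctorIso C b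
  let q : (homologyFunctor C b).obj G ⟶ Y :=
    (homologyFunctor C b).map (p ≫ e.hom) ≫ s.hom.app Y
  have hq : IsIso q := by
    dsimp only [q]
    rw [Functor.map_comp]
    infer_instance
  have h0 := h ((p ≫ e.hom) ≫ (singleFunctor C b).map (inv q ≫ α))
  have h1 : (homologyFunctor C b).map ((p ≫ e.hom) ≫ (singleFunctor C b).map (inv q ≫ α)) ≫
      s.hom.app K = 0 := by rw [h0]; simp
  have h2 := s.hom.naturality (inv q ≫ α)
  rw [Functor.map_comp, Category.assoc] at h1
  change (homologyFunctor C b).map ((singleFunctor C b).map (inv q ≫ α)) ≫ _ = _ at h2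
  rw [h2] at h1
  change _ ≫ s.hom.app Y ≫ inv q ≫ α = 0 at h1
  have h3 : q ≫ inv q ≫ α = 0 := by
    rw [← h1]; simp only [q, Category.assoc]
  simpa using h3

lemma aux_iso {F E : DerivedCategory C} (e : F ⟶ E) (K : C)
    (hbij : ∀ m : ℤ, Function.Bijective
      (fun c : E ⟶ ((singleFunctor C 0).obj K)⟦m⟧ => e ≫ c))
    (b : ℤ) (hFb : ∀ i, b < i → IsZero ((homologyFunctor C i).obj F))
    (hEb : ∀ i, b < i → IsZero ((homologyFunctor C i).obj E))
    (hF : ∀ i (Y : C), (∀ α : Y ⟶ K, α = 0) → ∀ β : Y ⟶ (homologyFunctor C i).obj F, β = 0)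
    (hE : ∀ i (Y : C), (∀ α : Y ⟶ K, α = 0) → ∀ β : Y ⟶ (homologyFunctor C i).obj E, β = 0)
    (hreg : ∀ i, ∃ g : (homologyFunctor C i).obj E ⟶ (homologyFunctor C i).obj F,
      (homologyFunctor C i).map e ≫ g ≫ (homologyFunctor C i).map e = (homologyFunctor C i).map e) :
    IsIso e := by
  obtain ⟨G, p, d, hT⟩ := distinguished_cocone_triangle e
  have hG0 : ∀ (m : ℤ) (φ : G ⟶ ((singleFunctor C 0).obj K)⟦m⟧), φ = 0 := by
    intro m φ
    have h1 : p ≫ φ = 0 := by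
      apply (hbij m).1
      have : e ≫ p = 0 := comp_distTriang_mor_zero₁₂ _ hT
      simp [reassoc_of% this]
    obtain ⟨ψ, hψ⟩ := Triangle.yoneda_exact₃ _ hT φ h1
    change F⟦(1:ℤ)⟧ ⟶ _ at ψ
    change φ = d ≫ ψ at hψ
    let s := (shiftFunctorAdd' (DerivedCategory C) (m-1) 1 m (by ring)).app ((singleFunctor C 0).obj K)
    obtain ⟨ψ', hψ'⟩ := (shiftFunctor (DerivedCategory C) (1:ℤ)).map_surjective (ψ ≫ s.hom)
    obtain ⟨c, hc⟩ := (hbij (m-1)).2 ψ'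
    have h2 : d ≫ (shiftFunctor (DerivedCategory C) (1:ℤ)).map e = 0 := comp_distTriang_mor_zero₃₁ _ hT
    have h3 : φ ≫ s.hom = 0 := by
      rw [hψ, Category.assoc, ← hψ', ← hc]
      simp only [Functor.map_comp]
      rw [reassoc_of% h2, zero_comp]
    simpa using h3
  have hG1 : ∀ (n : ℤ) (φ : G ⟶ (singleFunctor C n).obj K), φ = 0 := by
    intro n φ
    let s := ((singleFunctors C).shiftIso (-n) n 0 (by ring)).app K
    have := hG0 (-n) (φ ≫ s.inv)
    simpa using this
  have key : ∀ j : ℤ, G.IsLE j → IsZero ((homologyFunctor C j).obj G) := by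
    intro j hj
    have hY := aux_trunc G j hj K (hG1 j)
    have hp : Epi ((homologyFunctor C j).map p) :=
      (HomologySequence.epi_homologyMap_mor₂_iff _ hT j (j+1) rfl).2 (hF (j+1) _ hY _)
    obtain ⟨g, hg⟩ := hreg j
    have hex := HomologySequence.exact₂ _ hT j
    have hp' : (homologyFunctor C j).map e ≫ (homologyFunctor C j).map p = 0 := by
      have : e ≫ p = 0 := comp_distTriang_mor_zero₁₂ _ hT
      rw [← Functor.map_comp, this, Functor.map_zero]
    have h1 : (homologyFunctor C j).map e ≫ (𝟙 _ - g ≫ (homologyFunctor C j).map e) = 0 := by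
      rw [Preadditive.comp_sub, hg]; simp
    obtain ⟨q, hq⟩ : ∃ q, (homologyFunctor C j).map p ≫ q =
        𝟙 _ - g ≫ (homologyFunctor C j).map e := by
      have : Epi ((homologyFunctor C j).map (Triangle.mk e p d).mor₂) := hp
      exact hex.desc' _ h1
    rw [hE j _ hY q, comp_zero, eq_comm, sub_eq_zero] at hq
    have h2 : (homologyFunctor C j).map p = 0 := by
      rw [← Category.id_comp ((homologyFunctor C j).map p), hq, Category.assoc, hp', comp_zero]
    rw [IsZero.iff_id_eq_zero, ← cancel_epi ((homologyFunctor C j).map p), h2]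
    simp
  have key2 : ∀ (n : ℕ) , G.IsLE (b - n) := by
    intro n
    induction n with
    | zero =>
      rw [isLE_iff]
      intro i hi
      have hex := HomologySequence.exact₃ _ hT i (i+1) rfl
      exact hex.isZero_of_both_zeros ((hEb i (by simpa using hi)).eq_of_src _ _)
        ((hFb (i+1) (by push_cast at hi; lia)).eq_of_tgt _ _)
    | succ n ih =>
      rw [isLE_iff]
      intro i hi
      rcases eq_or_lt_of_le (show b - n ≤ i by push_cast at hi; lia) with h | h
      · subst h; exact key _ ih
      · exact isZero_of_isLE G (b-n) i h
  rw [isIso_iff]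
  have hz : ∀ i, IsZero ((homologyFunctor C i).obj G) := by
    intro i
    have := key2 (b - i + 1).toNat
    by_cases h : b < i
    · have := key2 0
      exact isZero_of_isLE G (b-(0:ℕ)) i (by simpa using h)
    · exact isZero_of_isLE G (b-((b - i + 1).toNat : ℕ)) i (by lia)
  intro i
  have h1 : Mono ((homologyFunctor C i).map e) :=
      (HomologySequence.mono_homologyMap_mor₁_iff _ hT (i-1) i (by ring)).2 ((hz _).eq_of_src _ _)
  have h2 : Epi ((homologyFunctor C i).map e) :=
      (HomologySequence.epi_homologyMap_mor₁_iff _ hT i).2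
        ((hz _).eq_of_tgt _ _)
  exact isIso_of_mono_of_epi _
end general

section assembly
open DerivedCategory

variable {k : Type} [Field k] {X : TopCat.{0}}

instance cSh_additive : (constantSheaf (Opens.grothendieckTopology X) (ModuleCat.{0} k)).Additive := by
  have : PreservesColimits (constantSheaf (Opens.grothendieckTopology X) (ModuleCat.{0} k)) :=
    (constantSheafAdj (Opens.grothendieckTopology X) (ModuleCat.{0} k)
      (T := ⊤) isTerminalTop).leftAdjoint_preservesColimits
  have := preservesBinaryBiproducts_of_preservesBinaryCoproducts
    (constantSheaf (Opens.grothendieckTopology X) (ModuleCat.{0} k))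
  exact Functor.additive_of_preservesBinaryBiproducts _

lemma hom_cSh_zero {r : ℕ} (Y : Sheaf (Opens.grothendieckTopology X) (ModuleCat.{0} k))
    (hY : ∀ α : Y ⟶ cSh X (ModuleCat.of k k), α = 0)
    (β : Y ⟶ cSh X (ModuleCat.of k (Fin r → k))) : β = 0 := by
  let P := constantSheaf (Opens.grothendieckTopology X) (ModuleCat.{0} k)
  let pr : ∀ i : Fin r, ModuleCat.of k (Fin r → k) ⟶ ModuleCat.of k k :=
    fun i => ModuleCat.ofHom (LinearMap.proj i)
  let inc : ∀ i : Fin r, ModuleCat.of k k ⟶ ModuleCat.of k (Fin r → k) :=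
    fun i => ModuleCat.ofHom (LinearMap.single k (fun _ => k) i)
  have hid : 𝟙 (ModuleCat.of k (Fin r → k)) = ∑ i, pr i ≫ inc i := by
    apply ModuleCat.hom_ext
    rw [ModuleCat.hom_sum]
    apply LinearMap.ext
    intro v
    rw [LinearMap.sum_apply]
    exact (Finset.univ_sum_single v).symm
  have h2 : β = β ≫ P.map (𝟙 _) := by
    rw [P.map_id]; exact (Category.comp_id _).symm
  rw [h2, hid, Functor.map_sum, Preadditive.comp_sum]
  apply Finset.sum_eq_zero
  intro i _
  rw [P.map_comp, ← Category.assoc, hY (β ≫ P.map (pr i)), zero_comp]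

end assembly

section assembly2
open DerivedCategory

variable {C : Type*} [Category C] [Abelian C] [HasDerivedCategory C]

lemma single_homology (K : C) (n i : ℤ) :
    (i = -n ∧ Nonempty ((homologyFunctor C i).obj (((singleFunctor C 0).obj K)⟦n⟧) ≅ K)) ∨
    (i ≠ -n ∧ IsZero ((homologyFunctor C i).obj (((singleFunctor C 0).obj K)⟦n⟧))) := by
  let s := ((singleFunctors C).shiftIso n (-n) 0 (by ring)).app K
  by_cases h : i = -n
  · left
    refine ⟨h, ⟨?_⟩⟩
    subst h
    exact (homologyFunctor C (-n)).mapIso s ≪≫ (singleFunctorCompHomologyFunctorIso C (-n)).app K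
  · right
    refine ⟨h, ?_⟩
    refine IsZero.of_iso ?_ ((homologyFunctor C i).mapIso s)
    change IsZero ((homologyFunctor C i).obj ((singleFunctor C (-n)).obj K))
    rcases lt_or_gt_of_ne h with h | h
    · exact isZero_of_isGE _ (-n) i h
    · exact isZero_of_isLE _ (-n) i h

lemma bij_lemma (F u : DerivedCategory C) (r : ℕ) (n : Fin r → ℤ)
    (e : ∀ i : Fin r, F ⟶ (shiftFunctor _ (2 * n i)).obj u) (m : ℤ)
    (hb : Function.Bijective
          (fun c : ∀ i : Fin r, u ⟶ (shiftFunctor _ (m - 2 * n i)).obj u =>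
            ∑ i : Fin r, e i ≫ (shiftFunctor _ (2 * n i)).map (c i) ≫
              (shiftFunctorAdd' _ (m - 2 * n i) (2 * n i) m (by ring)).inv.app u)) :
    Function.Bijective (fun c : (⨁ fun i : Fin r => (shiftFunctor _ (2 * n i)).obj u) ⟶
      (shiftFunctor _ m).obj u => biproduct.lift e ≫ c) := by
  have key : ∀ c : (⨁ fun i : Fin r => (shiftFunctor _ (2 * n i)).obj u) ⟶
      (shiftFunctor _ m).obj u, ∃ c' : ∀ i : Fin r, u ⟶ (shiftFunctor _ (m - 2 * n i)).obj u,
      ∀ i, biproduct.ι _ i ≫ c = (shiftFunctor _ (2 * n i)).map (c' i) ≫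
              (shiftFunctorAdd' _ (m - 2 * n i) (2 * n i) m (by ring)).inv.app u := by
    intro c
    have : ∀ i : Fin r, ∃ c' : u ⟶ (shiftFunctor _ (m - 2 * n i)).obj u,
       biproduct.ι _ i ≫ c = (shiftFunctor _ (2 * n i)).map c' ≫
              (shiftFunctorAdd' _ (m - 2 * n i) (2 * n i) m (by ring)).inv.app u := by
      intro i
      obtain ⟨c', hc'⟩ := (shiftFunctor (DerivedCategory C) (2 * n i)).map_surjective
        ((biproduct.ι (fun i : Fin r => (shiftFunctor _ (2 * n i)).obj u) i ≫ c) ≫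
          (shiftFunctorAdd' _ (m - 2 * n i) (2 * n i) m (by ring)).hom.app u)
      refine ⟨c', ?_⟩
      rw [hc', Category.assoc, Iso.hom_inv_id_app, Category.comp_id]
    choose c' hc' using this
    exact ⟨c', hc'⟩
  have sum_eq : ∀ c : (⨁ fun i : Fin r => (shiftFunctor _ (2 * n i)).obj u) ⟶
      (shiftFunctor _ m).obj u, biproduct.lift e ≫ c = ∑ i, e i ≫
        biproduct.ι (fun i : Fin r => (shiftFunctor _ (2 * n i)).obj u) i ≫ c := by
    intro c
    have : c = biproduct.desc (fun i => biproduct.ι _ i ≫ c) := by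
      apply biproduct.hom_ext'
      intro j; simp
    conv_lhs => rw [this, biproduct.lift_desc]
  constructor
  · intro c d h
    obtain ⟨c', hc'⟩ := key c
    obtain ⟨d', hd'⟩ := key d
    dsimp only at h
    rw [sum_eq, sum_eq] at h
    simp only [hc', hd'] at h
    have := hb.1 h
    subst this
    apply biproduct.hom_ext'
    intro j
    rw [hc', hd']
  · intro φ
    obtain ⟨c, hc⟩ := hb.2 φ
    refine ⟨biproduct.desc (fun i => (shiftFunctor _ (2 * n i)).map (c i) ≫
              (shiftFunctorAdd' _ (m - 2 * n i) (2 * n i) m (by ring)).inv.app u), ?_⟩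
    dsimp only
    rw [biproduct.lift_desc]
    exact hc
end assembly2

set_option maxHeartbeats 2000000 in
/-- Let `X` be a topological space of finite cohomological dimension
whose cohomology `H•(X;k)` with coefficients in a field `k` vanishes in odd degrees,
and let `F` be a bounded complex of sheaves of `k`-modules on `X` (an object of the
derived category of sheaves) whose cohomology sheaves are constant.  If
`Hom•(F, k_X)` is a free graded `H•(X;k)`-module generated in even degrees (i.e. it
admits a finite homogeneous basis `e i : F ⟶ k_X[2 nᵢ]` in even degrees), then `F` is
isomorphic in the derived category to a finite direct sum `⊕ k_X[2 nᵢ]` of even shifts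
of the constant sheaf. -/
theorem stmt13 (k : Type) [Field k] (X : TopCat.{0}) :
    ∀ (kX : Sheaf (Opens.grothendieckTopology X) (ModuleCat.{0} k))
      (_ : kX = (constantSheaf (Opens.grothendieckTopology X)
          (ModuleCat.{0} k)).obj (ModuleCat.of k k))
      (u : DerivedCategory (Sheaf (Opens.grothendieckTopology X) (ModuleCat.{0} k)))
      (_ : u = (DerivedCategory.singleFunctor _ 0).obj kX)
      -- `X` has finite cohomological dimension:
      (_ : ∃ d : ℕ, ∀ (G : Sheaf (Opens.grothendieckTopology X) (ModuleCat.{0} k))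
        (n : ℤ), (d : ℤ) < n →
        ∀ φ : u ⟶ (shiftFunctor _ n).obj ((DerivedCategory.singleFunctor _ 0).obj G),
          φ = 0)
      -- `H•(X;k)` vanishes in odd degrees:
      (_ : ∀ n : ℤ, Odd n → ∀ φ : u ⟶ (shiftFunctor _ n).obj u, φ = 0)
      (F : DerivedCategory (Sheaf (Opens.grothendieckTopology X) (ModuleCat.{0} k)))
      -- `F` is bounded:
      (_ : ∃ a b : ℤ, ∀ i : ℤ, (i < a ∨ b < i) →
        IsZero ((DerivedCategory.homologyFunctor _ i).obj F))
      -- the cohomology sheaves of `F` are constant: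
      (_ : ∀ i : ℤ, ∃ r : ℕ,
        Nonempty ((DerivedCategory.homologyFunctor _ i).obj F ≅
          (constantSheaf (Opens.grothendieckTopology X) (ModuleCat.{0} k)).obj
            (ModuleCat.of k (Fin r → k))))
      -- `Hom•(F, k_X)` is a free graded `H•(X;k)`-module generated in even degrees:
      (_ : ∃ (r : ℕ) (n : Fin r → ℤ)
          (e : ∀ i : Fin r, F ⟶ (shiftFunctor _ (2 * n i)).obj u),
        ∀ m : ℤ, Function.Bijective
          (fun c : ∀ i : Fin r, u ⟶ (shiftFunctor _ (m - 2 * n i)).obj u =>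
            ∑ i : Fin r, e i ≫ (shiftFunctor _ (2 * n i)).map (c i) ≫
              (shiftFunctorAdd' _ (m - 2 * n i) (2 * n i) m (by ring)).inv.app u)),
      ∃ (r : ℕ) (n : Fin r → ℤ),
        Nonempty (F ≅ ⨁ fun i : Fin r => (shiftFunctor _ (2 * n i)).obj u) := by
  rintro kX rfl u rfl - - F ⟨a, b, hFab⟩ hFc ⟨r, n, e, hb⟩
  refine ⟨r, n, ?_⟩
  let S := Sheaf (Opens.grothendieckTopology X) (ModuleCat.{0} k)
  let K : S := cSh X (ModuleCat.of k k)
  let D : Fin r → DerivedCategory S := fun i =>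
    (shiftFunctor _ (2 * n i)).obj ((DerivedCategory.singleFunctor S 0).obj K)
  let P := constantSheaf (Opens.grothendieckTopology X) (ModuleCat.{0} k)
  let H := DerivedCategory.homologyFunctor S
  have hEiso : ∀ i : ℤ, Nonempty ((H i).obj (⨁ D) ≅ ⨁ fun j => (H i).obj (D j)) :=
    fun i => ⟨(H i).mapBiproduct D⟩
  have hEz : ∀ i : ℤ, (∀ j, IsZero ((H i).obj (D j))) → IsZero ((H i).obj (⨁ D)) := by
    intro i hi
    obtain ⟨f⟩ := hEiso i
    refine IsZero.of_iso ?_ f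
    rw [IsZero.iff_id_eq_zero]
    apply biproduct.hom_ext
    intro j
    exact (hi j).eq_of_tgt _ _
  obtain ⟨b', hb'⟩ : ∃ b' : ℤ, b ≤ b' ∧ ∀ j, -(2 * n j) ≤ b' := by
    obtain ⟨M, hM⟩ := (Set.finite_range (fun j => -(2 * n j))).bddAbove
    exact ⟨max b M, le_max_left _ _, fun j => (hM ⟨j, rfl⟩).trans (le_max_right _ _)⟩
  have hiso : IsIso (biproduct.lift e : F ⟶ ⨁ D) := by
    refine aux_iso (C := S) _ K (fun m => bij_lemma F _ r n e m (hb m)) b' ?_ ?_ ?_ ?_ ?_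
    · intro i hi
      exact hFab i (Or.inr (lt_of_le_of_lt hb'.1 hi))
    · intro i hi
      refine hEz i fun j => ?_
      rcases single_homology K (2 * n j) i with h | h
      · have := hb'.2 j
        lia
      · exact h.2
    · intro i Y hY β
      obtain ⟨s, ⟨f⟩⟩ := hFc i
      have := hom_cSh_zero Y hY (β ≫ f.hom)
      rw [← cancel_mono f.hom, this, zero_comp]
    · intro i Y hY β
      obtain ⟨f⟩ := hEiso i
      rw [← cancel_mono f.hom, zero_comp]
      apply biproduct.hom_ext
      intro j
      rw [zero_comp]
      rcases single_homology K (2 * n j) i with ⟨-, ⟨g⟩⟩ | h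
      · rw [← cancel_mono g.hom, zero_comp]
        exact hY _
      · exact h.2.eq_of_tgt _ _
    · intro i
      obtain ⟨s, ⟨f⟩⟩ := hFc i
      have hW : ∀ j, ∃ W : ModuleCat.{0} k, Nonempty ((H i).obj (D j) ≅ P.obj W) := by
        intro j
        rcases single_homology K (2 * n j) i with ⟨-, ⟨g⟩⟩ | h
        · exact ⟨_, ⟨g⟩⟩
        · exact ⟨ModuleCat.of k PUnit.{1},
            ⟨h.2.iso (P.map_isZero (ModuleCat.isZero_of_subsingleton _))⟩⟩
      choose W hW using hW
      obtain ⟨q⟩ := hEiso i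
      let t : (H i).obj (⨁ D) ≅ P.obj (⨁ W) :=
        q ≪≫ biproduct.mapIso (fun j => (hW j).some) ≪≫ (P.mapBiproduct W).symm
      obtain ⟨g, hg⟩ := cSh_regular (f.inv ≫ (H i).map (biproduct.lift e : F ⟶ ⨁ D) ≫ t.hom)
      refine ⟨t.hom ≫ g ≫ f.inv, ?_⟩
      rw [← cancel_epi f.inv, ← cancel_mono t.hom]
      simpa only [Category.assoc] using hg
  exact ⟨asIso (biproduct.lift e : F ⟶ ⨁ D)⟩
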